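/- arXiv:1407.2773 — 4 statements merged into one kernel-verified Lean document; each statement's English description precedes it below -/
import Mathlib

section
/- Let M and M' be compact connected nonempty topological manifolds, let ψ : M × ℝ → M' × ℝ be a homeomorphism, and let T ∈ ℝ be such that ψ(M × {0}) ⊆ M' × (-∞, T) and M' × {T} ⊆ ψ(M × (0, +∞)). Define W := (M' × (-∞, T]) ∩ ψ(M × [0, +∞)) ⊆ M' × ℝ. Then the inclusion map of W into M' × ℝ is a homotopy equivalence. -/
/-- For `f : C(ℝ, ℝ)`, the map `(y, t) ↦ (y, f t)` of `Y × ℝ` is homotopic to the identity. -/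
theorem homotopic_prodMap_id_real {Y : Type*} [TopologicalSpace Y] (f : C(ℝ, ℝ)) :
    ((ContinuousMap.id Y).prodMap f).Homotopic (ContinuousMap.id (Y × ℝ)) :=
  (ContinuousMap.Homotopic.refl (ContinuousMap.id Y)).prodMap
    (⟨ContinuousMap.Homotopy.affine f (ContinuousMap.id ℝ)⟩ : f.Homotopic (ContinuousMap.id ℝ))

/-- A self-map conjugate under a homeomorphism to a map homotopic to the identity is homotopic
to the identity. -/
theorem Homeomorph.homotopic_id_conj {X Y : Type*} [TopologicalSpace X] [TopologicalSpace Y]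
    (e : X ≃ₜ Y) {f : C(X, X)} (hf : f.Homotopic (ContinuousMap.id X)) :
    ((e : C(X, Y)).comp (f.comp (e.symm : C(Y, X)))).Homotopic (ContinuousMap.id Y) := by
  have h := (ContinuousMap.Homotopic.refl (e : C(X, Y))).comp
    (hf.comp (ContinuousMap.Homotopic.refl (e.symm : C(Y, X))))
  have he : (e : C(X, Y)).comp ((ContinuousMap.id X).comp (e.symm : C(Y, X))) =
      ContinuousMap.id Y := by
    ext y
    simp
  rwa [he] at h


/-- The cobordism `W := (M' × (-∞, T]) ∩ ψ (M × [0, +∞))`, regarded as a subset of `M' × ℝ`,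
constructed from a homeomorphism `ψ : M × ℝ ≃ₜ M' × ℝ` and a real number `T`. -/
def cobordismSet {M M' : Type*} [TopologicalSpace M] [TopologicalSpace M']
    (ψ : (M × ℝ) ≃ₜ (M' × ℝ)) (T : ℝ) : Set (M' × ℝ) :=
  (Set.univ ×ˢ Set.Iic T) ∩ (ψ '' (Set.univ ×ˢ Set.Ici (0 : ℝ)))

/-- Let `M` and `M'` be compact connected nonempty topological manifolds, let
`ψ : M × ℝ → M' × ℝ` be a homeomorphism, and let `T ∈ ℝ` be such that
`ψ (M × {0}) ⊆ M' × (-∞, T)` and `M' × {T} ⊆ ψ (M × (0, +∞))`.  Let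
`W := (M' × (-∞, T]) ∩ ψ (M × [0, +∞)) ⊆ M' × ℝ`.  Then the inclusion of `W` into `M' × ℝ`
is a homotopy equivalence: there is a continuous `r : M' × ℝ → W` whose restriction to `W`
is homotopic to the identity of `W` and such that `incl ∘ r` is homotopic to the identity
of `M' × ℝ`. -/
theorem inclusion_cobordismSet_homotopyEquiv
    (m m' : ℕ) (M M' : Type*)
    [TopologicalSpace M] [T2Space M] [SecondCountableTopology M]
    [ChartedSpace (EuclideanSpace ℝ (Fin m)) M] [CompactSpace M] [ConnectedSpace M] [Nonempty M]
    [TopologicalSpace M'] [T2Space M'] [SecondCountableTopology M']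
    [ChartedSpace (EuclideanSpace ℝ (Fin m')) M'] [CompactSpace M'] [ConnectedSpace M']
    [Nonempty M']
    (ψ : (M × ℝ) ≃ₜ (M' × ℝ)) (T : ℝ)
    (h1 : ψ '' (Set.univ ×ˢ {(0 : ℝ)}) ⊆ Set.univ ×ˢ Set.Iio T)
    (h2 : (Set.univ ×ˢ {T} : Set (M' × ℝ)) ⊆ ψ '' (Set.univ ×ˢ Set.Ioi (0 : ℝ))) :
    ∃ r : C(M' × ℝ, cobordismSet ψ T),
      (r.comp ⟨Subtype.val, continuous_subtype_val⟩).Homotopic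
        (ContinuousMap.id (cobordismSet ψ T)) ∧
      ((⟨Subtype.val, continuous_subtype_val⟩ : C(cobordismSet ψ T, M' × ℝ)).comp r).Homotopic
        (ContinuousMap.id (M' × ℝ)) := by
  let a : C(M' × ℝ, M' × ℝ) :=
    (ContinuousMap.id M').prodMap ⟨fun t => min t T, by fun_prop⟩
  let b : C(M × ℝ, M × ℝ) :=
    (ContinuousMap.id M).prodMap ⟨fun t => max t 0, by fun_prop⟩
  let c : C(M' × ℝ, M' × ℝ) :=
    (ψ : C(M × ℝ, M' × ℝ)).comp (b.comp (ψ.symm : C(M' × ℝ, M × ℝ)))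
  have hmem : ∀ p, a (c p) ∈ cobordismSet ψ T := by
    intro p
    refine ⟨⟨trivial, min_le_right (c p).2 T⟩, ?_⟩
    rcases le_total (c p).2 T with h | h
    · have : a (c p) = c p := Prod.ext rfl (min_eq_left h)
      rw [this]
      exact ⟨b (ψ.symm p), ⟨trivial, le_max_right (ψ.symm p).2 0⟩, rfl⟩
    · have : a (c p) = ((c p).1, T) := Prod.ext rfl (min_eq_right h)
      rw [this]
      exact Set.image_mono (Set.prod_mono_right Set.Ioi_subset_Ici_self) (h2 ⟨trivial, rfl⟩)
  have hfix : ∀ p ∈ cobordismSet ψ T, a (c p) = p := by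
    rintro _ ⟨⟨-, hT⟩, q, ⟨-, hq⟩, rfl⟩
    have hb : b q = q := Prod.ext rfl (max_eq_left hq)
    have hc : c (ψ q) = ψ q := by
      change ψ (b (ψ.symm (ψ q))) = ψ q
      rw [ψ.symm_apply_apply, hb]
    rw [hc]
    exact Prod.ext rfl (min_eq_left hT)
  refine ⟨⟨fun p => ⟨a (c p), hmem p⟩, by fun_prop⟩, ?_, ?_⟩
  · convert ContinuousMap.Homotopic.refl (ContinuousMap.id (cobordismSet ψ T)) using 1
    ext1 p
    exact Subtype.ext (hfix p p.2)
  · exact (homotopic_prodMap_id_real _).comp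
      (ψ.homotopic_id_conj (homotopic_prodMap_id_real _))
end

section
/- Let M and M' be compact connected nonempty topological manifolds, let ψ : M × ℝ → M' × ℝ be a homeomorphism, and let T ∈ ℝ be such that ψ(M × {0}) ⊆ M' × (-∞, T) and M' × {T} ⊆ ψ(M × (0, +∞)). Define W := (M' × (-∞, T]) ∩ ψ(M × [0, +∞)) ⊆ M' × ℝ. Then the inclusion map of the subset ψ(M × {0}) into W is a homotopy equivalence. -/
/-- Truncating the height at `T` maps `ψ (M × [0, +∞))` into the cobordism as soon as
`M' × {T} ⊆ ψ (M × (0, +∞))`. -/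
theorem truncate_mem_cobordismSet {M M' : Type*} [TopologicalSpace M] [TopologicalSpace M']
    (ψ : (M × ℝ) ≃ₜ (M' × ℝ)) (T : ℝ)
    (h : (Set.univ ×ˢ {T} : Set (M' × ℝ)) ⊆ ψ '' (Set.univ ×ˢ Set.Ioi (0 : ℝ)))
    (x : M) {u : ℝ} (hu : 0 ≤ u) :
    ((ψ (x, u)).1, min (ψ (x, u)).2 T) ∈ cobordismSet ψ T := by
  refine ⟨by simp, ?_⟩
  rcases le_total (ψ (x, u)).2 T with hT | hT
  · rw [min_eq_left hT]
    exact ⟨(x, u), by simpa using hu, rfl⟩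
  · rw [min_eq_right hT]
    exact Set.image_mono (Set.prod_mono_right Set.Ioi_subset_Ici_self) (h (by simp))

theorem symm_snd_nonneg_of_mem_cobordismSet {M M' : Type*} [TopologicalSpace M]
    [TopologicalSpace M'] {ψ : (M × ℝ) ≃ₜ (M' × ℝ)} {T : ℝ} {w : M' × ℝ}
    (hw : w ∈ cobordismSet ψ T) : 0 ≤ (ψ.symm w).2 := by
  obtain ⟨-, p, hp, rfl⟩ := hw
  simpa using hp

/-- Let `M` and `M'` be compact connected nonempty topological manifolds, let
`ψ : M × ℝ → M' × ℝ` be a homeomorphism, and let `T ∈ ℝ` be such that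
`ψ (M × {0}) ⊆ M' × (-∞, T)` and `M' × {T} ⊆ ψ (M × (0, +∞))`.  Let
`W := (M' × (-∞, T]) ∩ ψ (M × [0, +∞)) ⊆ M' × ℝ`.  Then `ψ (M × {0}) ⊆ W` and the inclusion
of `ψ (M × {0})` into `W` is a homotopy equivalence: there is a continuous
`r : W → ψ (M × {0})` whose restriction to `ψ (M × {0})` is homotopic to the identity and
such that `incl ∘ r` is homotopic to the identity of `W`. -/
theorem inclusion_image_zero_section_cobordismSet_homotopyEquiv
    (m m' : ℕ) (M M' : Type*)
    [TopologicalSpace M] [T2Space M] [SecondCountableTopology M]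
    [ChartedSpace (EuclideanSpace ℝ (Fin m)) M] [CompactSpace M] [ConnectedSpace M] [Nonempty M]
    [TopologicalSpace M'] [T2Space M'] [SecondCountableTopology M']
    [ChartedSpace (EuclideanSpace ℝ (Fin m')) M'] [CompactSpace M'] [ConnectedSpace M']
    [Nonempty M']
    (ψ : (M × ℝ) ≃ₜ (M' × ℝ)) (T : ℝ)
    (h1 : ψ '' (Set.univ ×ˢ {(0 : ℝ)}) ⊆ Set.univ ×ˢ Set.Iio T)
    (h2 : (Set.univ ×ˢ {T} : Set (M' × ℝ)) ⊆ ψ '' (Set.univ ×ˢ Set.Ioi (0 : ℝ))) :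
    ∃ (hAW : ψ '' (Set.univ ×ˢ {(0 : ℝ)}) ⊆ cobordismSet ψ T)
      (r : C(cobordismSet ψ T, ψ '' (Set.univ ×ˢ {(0 : ℝ)}))),
      (r.comp ⟨Set.inclusion hAW, continuous_inclusion hAW⟩).Homotopic
        (ContinuousMap.id (ψ '' (Set.univ ×ˢ {(0 : ℝ)}))) ∧
      ((⟨Set.inclusion hAW, continuous_inclusion hAW⟩ :
          C(ψ '' (Set.univ ×ˢ {(0 : ℝ)}), cobordismSet ψ T)).comp r).Homotopic
        (ContinuousMap.id (cobordismSet ψ T)) := by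
  have hAW : ψ '' (Set.univ ×ˢ {(0 : ℝ)}) ⊆ cobordismSet ψ T := fun w hw ↦
    ⟨⟨trivial, le_of_lt (Set.mem_Iio.1 (h1 hw).2)⟩, Set.image_mono (Set.prod_mono_right (by simp)) hw⟩
  let r : C(cobordismSet ψ T, ψ '' (Set.univ ×ˢ {(0 : ℝ)})) :=
    ⟨fun w ↦ ⟨ψ ((ψ.symm w).1, 0), _, by simp, rfl⟩, by fun_prop⟩
  refine ⟨hAW, r, ?_, ⟨⟨⟨fun p ↦ ⟨_, truncate_mem_cobordismSet ψ T h2 (ψ.symm p.2).1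
    (mul_nonneg p.1.2.1 (symm_snd_nonneg_of_mem_cobordismSet p.2.2))⟩, by fun_prop⟩, ?_, ?_⟩⟩⟩
  · convert ContinuousMap.Homotopic.refl _
    ext1 ⟨_, ⟨x, u⟩, hu, rfl⟩
    obtain rfl : u = 0 := hu.2
    simp [r]
  · intro w
    have hT : (ψ ((ψ.symm w).1, 0)).2 ≤ T := (h1 ⟨((ψ.symm w).1, 0), by simp, rfl⟩).2.le
    apply Subtype.ext
    simp [r, hT]
  · intro w
    have hT : (w : M' × ℝ).2 ≤ T := w.2.1.2
    apply Subtype.ext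
    simp [hT]
end

section
/- Let M and M' be compact connected nonempty topological manifolds, let ψ : M × ℝ → M' × ℝ be a homeomorphism, and let T ∈ ℝ be such that ψ(M × {0}) ⊆ M' × (-∞, T) and M' × {T} ⊆ ψ(M × (0, +∞)). Define W := (M' × (-∞, T]) ∩ ψ(M × [0, +∞)) ⊆ M' × ℝ. Then the inclusion map of the subset M' × {T} into W is a homotopy equivalence. -/
/-- If `ψ (M × [0, +∞))` contains `M' × {T}`, then there is a continuous map from all of `M' × ℝ`
to `cobordismSet ψ T` which is the identity on `cobordismSet ψ T`: push into `ψ (M × [0, +∞))`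
along the lines of `M × ℝ`, then push below level `T` along the lines of `M' × ℝ`. -/
theorem exists_retraction_cobordismSet {M M' : Type*} [TopologicalSpace M] [TopologicalSpace M']
    (ψ : (M × ℝ) ≃ₜ (M' × ℝ)) (T : ℝ)
    (hT : (Set.univ ×ˢ {T} : Set (M' × ℝ)) ⊆ ψ '' (Set.univ ×ˢ Set.Ici (0 : ℝ))) :
    ∃ ρ : C(M' × ℝ, cobordismSet ψ T), ∀ w : cobordismSet ψ T, ρ w = w := by
  let up : M' × ℝ → M' × ℝ := fun p ↦ ψ ((ψ.symm p).1, max (ψ.symm p).2 0)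
  let down : M' × ℝ → M' × ℝ := fun p ↦ (p.1, min p.2 T)
  have up_mem (p) : up p ∈ ψ '' (Set.univ ×ˢ Set.Ici (0 : ℝ)) :=
    ⟨_, ⟨trivial, Set.mem_Ici.2 (le_max_right _ _)⟩, rfl⟩
  have down_mem {p} (hp : p ∈ ψ '' (Set.univ ×ˢ Set.Ici (0 : ℝ))) :
      down p ∈ cobordismSet ψ T := by
    refine ⟨⟨trivial, Set.mem_Iic.2 (min_le_right _ _)⟩, ?_⟩
    rcases le_total p.2 T with h | h
    · simpa only [down, min_eq_left h] using hp
    · simpa only [down, min_eq_right h] using hT ⟨trivial, Set.mem_singleton T⟩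
  refine ⟨⟨fun p ↦ ⟨down (up p), down_mem (up_mem p)⟩, by fun_prop⟩, ?_⟩
  rintro ⟨_, ⟨-, hw⟩, ⟨x, t⟩, ⟨-, ht⟩, rfl⟩
  have ht' : max t 0 = t := max_eq_left ht
  have hw' : min (ψ (x, t)).2 T = (ψ (x, t)).2 := min_eq_left hw
  ext1
  simp [up, down, ht', hw']

/-- Let `M` and `M'` be compact connected nonempty topological manifolds, let
`ψ : M × ℝ → M' × ℝ` be a homeomorphism, and let `T ∈ ℝ` be such that
`ψ (M × {0}) ⊆ M' × (-∞, T)` and `M' × {T} ⊆ ψ (M × (0, +∞))`.  Let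
`W := (M' × (-∞, T]) ∩ ψ (M × [0, +∞)) ⊆ M' × ℝ`.  Then `M' × {T} ⊆ W` and the inclusion
of `M' × {T}` into `W` is a homotopy equivalence: there is a continuous `r : W → M' × {T}`
whose restriction to `M' × {T}` is homotopic to the identity and such that `incl ∘ r` is
homotopic to the identity of `W`. -/
theorem inclusion_top_boundary_cobordismSet_homotopyEquiv
    (m m' : ℕ) (M M' : Type*)
    [TopologicalSpace M] [T2Space M] [SecondCountableTopology M]
    [ChartedSpace (EuclideanSpace ℝ (Fin m)) M] [CompactSpace M] [ConnectedSpace M] [Nonempty M]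
    [TopologicalSpace M'] [T2Space M'] [SecondCountableTopology M']
    [ChartedSpace (EuclideanSpace ℝ (Fin m')) M'] [CompactSpace M'] [ConnectedSpace M']
    [Nonempty M']
    (ψ : (M × ℝ) ≃ₜ (M' × ℝ)) (T : ℝ)
    (h1 : ψ '' (Set.univ ×ˢ {(0 : ℝ)}) ⊆ Set.univ ×ˢ Set.Iio T)
    (h2 : (Set.univ ×ˢ {T} : Set (M' × ℝ)) ⊆ ψ '' (Set.univ ×ˢ Set.Ioi (0 : ℝ))) :
    ∃ (hAW : (Set.univ ×ˢ {T} : Set (M' × ℝ)) ⊆ cobordismSet ψ T)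
      (r : C(cobordismSet ψ T, (Set.univ ×ˢ {T} : Set (M' × ℝ)))),
      (r.comp ⟨Set.inclusion hAW, continuous_inclusion hAW⟩).Homotopic
        (ContinuousMap.id ((Set.univ ×ˢ {T} : Set (M' × ℝ)))) ∧
      ((⟨Set.inclusion hAW, continuous_inclusion hAW⟩ :
          C((Set.univ ×ˢ {T} : Set (M' × ℝ)), cobordismSet ψ T)).comp r).Homotopic
        (ContinuousMap.id (cobordismSet ψ T)) := by
  have hAU : (Set.univ ×ˢ {T} : Set (M' × ℝ)) ⊆ ψ '' (Set.univ ×ˢ Set.Ici (0 : ℝ)) :=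
    h2.trans (Set.image_mono (Set.prod_mono le_rfl Set.Ioi_subset_Ici_self))
  have hAW : (Set.univ ×ˢ {T} : Set (M' × ℝ)) ⊆ cobordismSet ψ T :=
    Set.subset_inter (Set.prod_mono le_rfl (by simp)) hAU
  obtain ⟨ρ, hρ⟩ := exists_retraction_cobordismSet ψ T hAU
  refine ⟨hAW, ⟨fun w ↦ ⟨(w.1.1, T), trivial, Set.mem_singleton T⟩, by fun_prop⟩, ?_, ?_⟩
  · convert ContinuousMap.Homotopic.refl _
    ext1 ⟨⟨x, t⟩, -, ht⟩
    obtain rfl : t = T := ht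
    rfl
  · refine ⟨⟨⟨fun q ↦ ρ (q.2.1.1, (1 - (q.1 : ℝ)) * T + q.1 * q.2.1.2), by fun_prop⟩, ?_, ?_⟩⟩
    · intro w
      simpa using hρ ⟨(w.1.1, T), hAW ⟨trivial, Set.mem_singleton T⟩⟩
    · intro w
      simpa using hρ w
end

section
/- Let M and M' be compact connected nonempty topological manifolds, let ψ : M × ℝ → M' × ℝ be a homeomorphism, and let T ∈ ℝ be such that ψ(M × {0}) ⊆ M' × (-∞, T) and M' × {T} ⊆ ψ(M × (0, +∞)). Then the set W := (M' × (-∞, T]) ∩ ψ(M × [0, +∞)) is a compact subset of M' × ℝ. -/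
/-- A continuous real function without zeros on a preconnected set that is positive at one point
of the set is positive on the whole set. -/
theorem IsPreconnected.pos_of_ne_zero {X : Type*} [TopologicalSpace X] {s : Set X}
    (hs : IsPreconnected s) {f : X → ℝ} (hf : Continuous f) (h0 : ∀ x ∈ s, f x ≠ 0)
    {p : X} (hp : p ∈ s) (hfp : 0 < f p) {x : X} (hx : x ∈ s) : 0 < f x := by
  by_contra! hneg
  obtain ⟨z, hz, hz0⟩ := hs.intermediate_value hx hp hf.continuousOn ⟨hneg, hfp.le⟩
  exact h0 z hz hz0

/-- The half-cylinder `X × (-∞, 0]` over a nonempty space is not compact. -/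
theorem not_isCompact_univ_prod_Iic {X : Type*} [TopologicalSpace X] [Nonempty X] :
    ¬ IsCompact (Set.univ ×ˢ Set.Iic (0 : ℝ) : Set (X × ℝ)) := by
  intro h
  have himage := h.image continuous_snd
  rw [Set.snd_image_prod Set.univ_nonempty] at himage
  exact not_bddBelow_Iic (0 : ℝ) himage.bddBelow

/-- Let `M` and `M'` be compact connected nonempty topological manifolds, let
`ψ : M × ℝ → M' × ℝ` be a homeomorphism, and let `T ∈ ℝ` be such that
`ψ (M × {0}) ⊆ M' × (-∞, T)` and `M' × {T} ⊆ ψ (M × (0, +∞))`.  Then the set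
`W := (M' × (-∞, T]) ∩ ψ (M × [0, +∞))` is a compact subset of `M' × ℝ`. -/
theorem isCompact_cobordismSet
    (m m' : ℕ) (M M' : Type*)
    [TopologicalSpace M] [T2Space M] [SecondCountableTopology M]
    [ChartedSpace (EuclideanSpace ℝ (Fin m)) M] [CompactSpace M] [ConnectedSpace M] [Nonempty M]
    [TopologicalSpace M'] [T2Space M'] [SecondCountableTopology M']
    [ChartedSpace (EuclideanSpace ℝ (Fin m')) M'] [CompactSpace M'] [ConnectedSpace M']
    [Nonempty M']
    (ψ : (M × ℝ) ≃ₜ (M' × ℝ)) (T : ℝ)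
    (h1 : ψ '' (Set.univ ×ˢ {(0 : ℝ)}) ⊆ Set.univ ×ˢ Set.Iio T)
    (h2 : (Set.univ ×ˢ {T} : Set (M' × ℝ)) ⊆ ψ '' (Set.univ ×ˢ Set.Ioi (0 : ℝ))) :
    IsCompact (cobordismSet ψ T) := by
  set g : M' × ℝ → ℝ := fun y => (ψ.symm y).2 with hg_def
  have hg : Continuous g := continuous_snd.comp ψ.symm.continuous
  have hzero : ∀ y, g y = 0 → y.2 < T := fun y hy =>
    (h1 ⟨ψ.symm y, ⟨trivial, hy⟩, ψ.apply_symm_apply y⟩).2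
  have htop : ∀ x : M', 0 < g (x, T) := by
    intro x
    obtain ⟨p, hp, hpx⟩ := h2 (show (x, T) ∈ Set.univ ×ˢ {T} from ⟨trivial, rfl⟩)
    simpa [hg_def, ← hpx] using hp.2
  have hupper : ∀ y : M' × ℝ, T ≤ y.2 → 0 < g y := fun y hy =>
    (isPreconnected_univ.prod isPreconnected_Ici).pos_of_ne_zero hg
      (s := Set.univ ×ˢ Set.Ici T) (fun z hz hz0 => (hzero z hz0).not_ge hz.2)
      (p := (y.1, T)) ⟨trivial, Set.self_mem_Ici⟩ (htop y.1) ⟨trivial, hy⟩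
  -- The zero set of `g` is compact, hence bounded below in the real direction.
  obtain ⟨b, hb⟩ : ∃ b : ℝ, ∀ y, g y = 0 → b ≤ y.2 := by
    have hcompact : IsCompact (ψ '' (Set.univ ×ˢ {(0 : ℝ)})) :=
      (isCompact_univ.prod isCompact_singleton).image ψ.continuous
    obtain ⟨b, hb⟩ := (hcompact.image continuous_snd).bddBelow
    exact ⟨b, fun y hy => hb ⟨y, ⟨ψ.symm y, ⟨trivial, hy⟩, ψ.apply_symm_apply y⟩, rfl⟩⟩
  have hlower : ∀ y : M' × ℝ, y.2 < b → g y < 0 := by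
    intro y hy
    by_contra! hpos
    have hne : ∀ z ∈ (Set.univ ×ˢ Set.Iio b : Set (M' × ℝ)), g z ≠ 0 :=
      fun z hz hz0 => (hb z hz0).not_gt hz.2
    have hall : ∀ z : M' × ℝ, z.2 < b → 0 < g z := fun z hz =>
      (isPreconnected_univ.prod isPreconnected_Iio).pos_of_ne_zero hg hne
        (p := y) ⟨trivial, hy⟩ (hpos.lt_of_ne' (hne y ⟨trivial, hy⟩)) ⟨trivial, hz⟩
    -- Both ends of `M' × ℝ` now lie in `0 < g`, so `ψ (M × (-∞, 0])` would be compact.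
    refine not_isCompact_univ_prod_Iic (X := M) (ψ.isCompact_image.mp ?_)
    refine (isCompact_univ.prod isCompact_Icc).of_isClosed_subset
      (s := Set.univ ×ˢ Set.Icc b T)
      (ψ.isClosedMap _ (isClosed_univ.prod isClosed_Iic)) ?_
    rintro _ ⟨p, hp, rfl⟩
    have hgp : g (ψ p) ≤ 0 := by simpa [hg_def] using hp.2
    exact ⟨trivial, not_lt.mp fun h => (hall _ h).not_ge hgp,
      not_lt.mp fun h => (hupper _ h.le).not_ge hgp⟩
  refine (isCompact_univ.prod isCompact_Icc).of_isClosed_subset (s := Set.univ ×ˢ Set.Icc b T)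
    ((isClosed_univ.prod isClosed_Iic).inter
      (ψ.isClosedMap _ (isClosed_univ.prod isClosed_Ici))) ?_
  rintro _ ⟨hT, p, hp, rfl⟩
  have hgp : 0 ≤ g (ψ p) := by simpa [hg_def] using hp.2
  exact ⟨trivial, not_lt.mp fun h => (hlower _ h).not_ge hgp, hT.2⟩
end
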